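/- Let Ω be a finite type, f : Finset Ω → ℝ be normalized, monotone, and submodular, and suppose f has elemental curvature at most κ ∈ [0,1]. Let A, B ⊆ Ω be finite subsets with m = |B \ A| ≥ 1, and let x₁, x₂, …, x_m be an enumeration (without repetition) of the elements of B \ A. Then f(A ∪ B) − f(A) ≤ Σ_{t=0}^{m−1} κ^t · (f(A ∪ {x_{t+1}}) − f(A)). -/

import Mathlib

/-- Elemental curvature `κ` compounds: adding `T` to `A` first shrinks the marginal gain of a new
element `y` by a factor `κ ^ #T`. -/
theorem marginal_union_le_pow_card_mul {Ω : Type*} [DecidableEq Ω]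
    {f : Finset Ω → ℝ} {κ : ℝ} (hκ0 : 0 ≤ κ)
    (hcurv : ∀ (S : Finset Ω) (x x' : Ω), x ≠ x' → x ∉ S → x' ∉ S →
      f (insert x (insert x' S)) - f (insert x' S) ≤ κ * (f (insert x S) - f S))
    {A T : Finset Ω} (hT : Disjoint A T) {y : Ω} (hyA : y ∉ A) (hyT : y ∉ T) :
    f (insert y (A ∪ T)) - f (A ∪ T) ≤ κ ^ T.card * (f (insert y A) - f A) := by
  induction T using Finset.induction_on with
  | empty => simp
  | insert z T hz ih =>
    rw [Finset.disjoint_insert_right] at hT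
    rw [Finset.mem_insert, not_or] at hyT
    rw [Finset.union_insert, Finset.card_insert_of_notMem hz, pow_succ', mul_assoc]
    exact (hcurv (A ∪ T) y z hyT.1 (by simp [hyA, hyT.2]) (by simp [hT.1, hz])).trans
      (mul_le_mul_of_nonneg_left (ih hT.2 hyT.2) hκ0)

theorem union_image_sub_le_sum_pow_mul {Ω : Type*} [DecidableEq Ω]
    {f : Finset Ω → ℝ} {κ : ℝ} (hκ0 : 0 ≤ κ)
    (hcurv : ∀ (S : Finset Ω) (x x' : Ω), x ≠ x' → x ∉ S → x' ∉ S →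
      f (insert x (insert x' S)) - f (insert x' S) ≤ κ * (f (insert x S) - f S))
    {A : Finset Ω} {m : ℕ} {x : Fin m → Ω} (hinj : Function.Injective x)
    (hmem : ∀ t, x t ∉ A) :
    f (A ∪ Finset.univ.image x) - f A ≤
      ∑ t : Fin m, κ ^ (t : ℕ) * (f (insert (x t) A) - f A) := by
  induction m with
  | zero => simp
  | succ m ih =>
    have hinj' : Function.Injective fun t : Fin m => x t.castSucc :=
      hinj.comp (Fin.castSucc_injective m)
    have himage : Finset.univ.image x =
        insert (x (Fin.last m)) (Finset.univ.image fun t : Fin m => x t.castSucc) := by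
      ext b
      simp [Fin.exists_iff_castSucc, eq_comm]
    have hlast : x (Fin.last m) ∉ Finset.univ.image fun t : Fin m => x t.castSucc := by
      simp [hinj.eq_iff, Fin.castSucc_ne_last]
    have hdisj : Disjoint A (Finset.univ.image fun t : Fin m => x t.castSucc) := by
      rw [Finset.disjoint_right]
      simp [hmem]
    have hstep := marginal_union_le_pow_card_mul hκ0 hcurv hdisj (hmem (Fin.last m)) hlast
    rw [Finset.card_image_of_injective _ hinj', Finset.card_fin] at hstep
    rw [himage, Finset.union_insert, Fin.sum_univ_castSucc]
    have hinit := ih hinj' fun t => hmem t.castSucc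
    simp only [Fin.val_castSucc, Fin.val_last]
    linarith

/-- **Eq. (26) in the proof of the paper's Lemma 4.** For a normalized, monotone,
submodular `f` with elemental curvature at most `κ ∈ [0,1]`, sets `A, B` with
`m = |B \ A| ≥ 1`, and any enumeration `x : Fin m → Ω` (without repetition) of the
elements of `B \ A`,
`f(A ∪ B) − f(A) ≤ Σ_{t=0}^{m−1} κ^t · (f(A ∪ {x_{t+1}}) − f(A))`. -/
theorem submodular_union_enumeration_bound
    {Ω : Type*} [Fintype Ω] [DecidableEq Ω]
    (f : Finset Ω → ℝ) (κ : ℝ)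
    (hκ0 : 0 ≤ κ) (hκ1 : κ ≤ 1)
    (hnorm : f ∅ = 0)
    (hmono : ∀ S S' : Finset Ω, S ⊆ S' → f S ≤ f S')
    (hsub : ∀ (S S' : Finset Ω) (x : Ω), S ⊆ S' → x ∉ S' →
      f (insert x S') - f S' ≤ f (insert x S) - f S)
    (hcurv : ∀ (S : Finset Ω) (x x' : Ω), x ≠ x' → x ∉ S → x' ∉ S →
      f (insert x (insert x' S)) - f (insert x' S) ≤ κ * (f (insert x S) - f S))
    (A B : Finset Ω) (m : ℕ) (hm : m = (B \ A).card) (hm1 : 1 ≤ m)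
    (x : Fin m → Ω)
    (hinj : Function.Injective x)
    (hmem : ∀ t : Fin m, x t ∈ B \ A)
    (hsurj : ∀ b ∈ B \ A, ∃ t : Fin m, x t = b) :
    f (A ∪ B) - f A ≤ ∑ t : Fin m, κ ^ (t : ℕ) * (f (insert (x t) A) - f A) := by
  have hunion : A ∪ B = A ∪ Finset.univ.image x := by
    rw [← Finset.union_sdiff_self_eq_union]
    congr 1
    ext b
    simp only [Finset.mem_image, Finset.mem_univ, true_and]
    exact ⟨hsurj b, fun ⟨t, ht⟩ => ht ▸ hmem t⟩
  rw [hunion]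
  exact union_image_sub_le_sum_pow_mul hκ0 hcurv hinj fun t => (Finset.mem_sdiff.mp (hmem t)).2
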